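/- arXiv:2508.18844 — 3 statements merged into one kernel-verified Lean document; each statement's English description precedes it below -/
import Mathlib

section
/- Let 1 ≤ ℓ ≤ m and let Π be a hyperplane of the Plücker projective space P(⋀^ℓ V). Then |Π ∩ G(ℓ,V)| ≤ [m ℓ]_q − q^{ℓ(m−ℓ)}. -/
open Module

/-- The Gaussian binomial coefficient `[m ℓ]_q`, as a rational number. -/
noncomputable def gaussBinom (q m l : ℕ) : ℚ :=
  ∏ i ∈ Finset.range l, ((q : ℚ) ^ (m - i) - 1) / ((q : ℚ) ^ (i + 1) - 1)

/-- `e(ℓ,m) = [m ℓ]_q − q^{ℓ(m−ℓ)}`. -/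
noncomputable def eG (q l m : ℕ) : ℚ :=
  gaussBinom q m l - (q : ℚ) ^ (l * (m - l))

/-- `e'(ℓ,m) = [m ℓ]_q − q^{ℓ(m−ℓ)} − q^{ℓ(m−ℓ)−2}`. -/
noncomputable def eG' (q l m : ℕ) : ℚ :=
  gaussBinom q m l - (q : ℚ) ^ (l * (m - l)) - (q : ℚ) ^ (l * (m - l) - 2)

variable (F : Type*) [Field F] (V : Type*) [AddCommGroup V] [Module F V]

/-- The wedge product `v₁ ∧ ⋯ ∧ vₙ` as an element of the `n`-th exterior power. -/
noncomputable def wedge (n : ℕ) (v : Fin n → V) : ⋀[F]^n V :=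
  ⟨ExteriorAlgebra.ιMulti F n v, ExteriorAlgebra.ιMulti_range F n (Set.mem_range_self v)⟩

/-- The product `w₁ ∧ ⋯ ∧ w_k ∧ x` for `x` in the `l`-th exterior power, landing in the
`n`-th exterior power, where `k + l = n`. -/
noncomputable def mulWedge (k l n : ℕ) (h : k + l = n) (w : Fin k → V) (x : ⋀[F]^l V) :
    ⋀[F]^n V :=
  ⟨ExteriorAlgebra.ιMulti F k w * (x : ExteriorAlgebra F V), by
    subst h
    have hmem : ExteriorAlgebra.ιMulti F k w * (x : ExteriorAlgebra F V) ∈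
        (LinearMap.range (ExteriorAlgebra.ι F : V →ₗ[F] ExteriorAlgebra F V)) ^ k *
          (LinearMap.range (ExteriorAlgebra.ι F : V →ₗ[F] ExteriorAlgebra F V)) ^ l :=
      Submodule.mul_mem_mul (ExteriorAlgebra.ιMulti_range F k (Set.mem_range_self w)) x.2
    rw [← pow_add] at hmem
    exact hmem⟩

/-- An `ℓ`-dimensional subspace `L` of `V` lies on the hyperplane of the Plücker projective
space determined by the nonzero functional `φ : ⋀[F]^ℓ V →ₗ[F] F` if
`φ (ω₁ ∧ ⋯ ∧ ω_ℓ) = 0` for some (equivalently, every) basis `ω₁, …, ω_ℓ` of `L`. -/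
def LiesOn (l : ℕ) (φ : ⋀[F]^l V →ₗ[F] F) (L : Submodule F V) : Prop :=
  ∃ ω : Fin l → V, (∀ i, ω i ∈ L) ∧ LinearIndependent F ω ∧
    Submodule.span F (Set.range ω) = L ∧ φ (wedge F V l ω) = 0

/-- The hyperplane determined by `φ : ⋀[F]^ℓ V →ₗ[F] F` is decomposable if there exist vectors
`w₁, …, w_{m−ℓ} ∈ V` and a nonzero linear functional `ψ : ⋀[F]^m V →ₗ[F] F` such that
`φ x = ψ (w₁ ∧ ⋯ ∧ w_{m−ℓ} ∧ x)` for all `x ∈ ⋀[F]^ℓ V`. -/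
def IsDecomposable (m l : ℕ) (h : l ≤ m) (φ : ⋀[F]^l V →ₗ[F] F) : Prop :=
  ∃ (w : Fin (m - l) → V) (ψ : ⋀[F]^m V →ₗ[F] F), ψ ≠ 0 ∧
    ∀ x : ⋀[F]^l V, φ x = ψ (mulWedge F V (m - l) l m (Nat.sub_add_cancel h) w x)

/-- If an alternating map does not vanish at `v`, its contractions with the `v i` are linearly
independent. -/
theorem AlternatingMap.linearIndependent_curryLeft {K M N : Type*} [Field K] [AddCommGroup M]
    [Module K M] [AddCommGroup N] [Module K N] {n : ℕ} (f : M [⋀^Fin n.succ]→ₗ[K] N)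
    {v : Fin n.succ → M} (hv : f v ≠ 0) : LinearIndependent K fun i => f.curryLeft (v i) := by
  have vanish : ∀ (w : Fin n.succ → M) (i : Fin n.succ), f.curryLeft (w i) = 0 → f w = 0 := by
    intro w i hw
    have h0 : f (w ∘ Equiv.swap 0 i) = 0 := by
      have h1 : f.curryLeft (w i) (Matrix.vecTail (w ∘ Equiv.swap 0 i)) = 0 := by rw [hw]; rfl
      rw [AlternatingMap.curryLeft_apply_apply] at h1
      convert h1
      conv_lhs => rw [← Matrix.cons_head_tail (w ∘ Equiv.swap 0 i)]
      simp [Matrix.vecHead]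
    rw [f.map_perm] at h0
    exact (smul_eq_zero_iff_eq _).1 h0
  rw [Fintype.linearIndependent_iff]
  intro c hc i
  have h0 : f.curryLeft (∑ j, c j • v j) = 0 := by simpa using hc
  have h1 := vanish (Function.update v i (∑ j, c j • v j)) i (by simpa using h0)
  rw [f.map_update_sum, Finset.sum_eq_single i] at h1
  · rw [f.map_update_smul, Function.update_eq_self] at h1
    exact (smul_eq_zero.1 h1).resolve_right hv
  · intro j _ hj
    rw [f.map_update_smul, f.map_update_self _ hj.symm, smul_zero]
  · simp

/-- The kernel of the contraction `x ↦ f (x, ·)` of a nonzero alternating form of degree `n + 1`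
has codimension at least `n + 1`. -/
theorem AlternatingMap.finrank_ker_curryLeft_le {K M : Type*} [Field K] [AddCommGroup M]
    [Module K M] [FiniteDimensional K M] {n : ℕ} {f : M [⋀^Fin n.succ]→ₗ[K] K} (hf : f ≠ 0) :
    finrank K (LinearMap.ker f.curryLeft) ≤ finrank K M - (n + 1) := by
  obtain ⟨v, hv⟩ : ∃ v, f v ≠ 0 := by
    by_contra! h
    exact hf (AlternatingMap.ext h)
  have hr : n + 1 ≤ finrank K (LinearMap.range f.curryLeft) := by
    have hli : LinearIndependent K
        fun i => (⟨f.curryLeft (v i), v i, rfl⟩ : LinearMap.range f.curryLeft) :=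
      LinearIndependent.of_comp (LinearMap.range f.curryLeft).subtype
        (f.linearIndependent_curryLeft hv)
    simpa using hli.fintype_card_le_finrank
  have := f.curryLeft.finrank_range_add_finrank_ker
  omega

/-- A lower bound for the number of tuples at which a nonzero alternating form over a finite field
does not vanish. -/
theorem AlternatingMap.prod_le_card_ne_zero {K M : Type*} [Field K] [Fintype K] [AddCommGroup M]
    [Module K M] [FiniteDimensional K M] {n : ℕ} (f : M [⋀^Fin n]→ₗ[K] K) (hf : f ≠ 0) :
    ∏ j ∈ Finset.range n,
      (Fintype.card K ^ finrank K M - Fintype.card K ^ (finrank K M - (j + 1))) ≤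
        Nat.card {v : Fin n → M // f v ≠ 0} := by
  classical
  have : Finite M := Module.finite_of_finite K
  have := Fintype.ofFinite M
  induction n with
  | zero =>
    have : Nonempty {v : Fin 0 → M // f v ≠ 0} := by
      by_contra h
      exact hf (AlternatingMap.ext fun v => by_contra fun hv => h ⟨v, hv⟩)
    rw [Finset.range_zero, Finset.prod_empty]
    exact Nat.card_pos
  | succ n ih =>
    have hcard : Fintype.card K ^ finrank K M - Fintype.card K ^ (finrank K M - (n + 1)) ≤
        Fintype.card {x : M // f.curryLeft x ≠ 0} := by
      have hker : Nat.card {x : M // f.curryLeft x = 0} ≤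
          Fintype.card K ^ (finrank K M - (n + 1)) :=
        calc Nat.card (LinearMap.ker f.curryLeft)
            = Fintype.card K ^ finrank K (LinearMap.ker f.curryLeft) := by
              rw [Module.natCard_eq_pow_finrank (K := K), Nat.card_eq_fintype_card]
          _ ≤ _ := Nat.pow_le_pow_right Fintype.card_pos (finrank_ker_curryLeft_le hf)
      rw [Nat.card_eq_fintype_card] at hker
      rw [← Module.card_eq_pow_finrank (K := K) (V := M),
        Fintype.card_subtype_compl fun x : M => f.curryLeft x = 0]
      exact Nat.sub_le_sub_left hker _
    let g : (Σ x : {x : M // f.curryLeft x ≠ 0}, {w : Fin n → M // f.curryLeft x.1 w ≠ 0}) →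
        {v : Fin (n + 1) → M // f v ≠ 0} := fun p => ⟨Matrix.vecCons p.1.1 p.2.1, p.2.2⟩
    have hg : Function.Injective g := by
      rintro ⟨⟨x, hx⟩, w, hw⟩ ⟨⟨y, hy⟩, w', hw'⟩ h
      have h : Matrix.vecCons x w = Matrix.vecCons y w' := congrArg Subtype.val h
      obtain ⟨rfl, rfl⟩ := Matrix.vecCons_inj.1 h
      rfl
    refine le_trans ?_ (Nat.card_le_card_of_injective g hg)
    rw [Nat.card_sigma, Finset.prod_range_succ, mul_comm]
    refine (Nat.mul_le_mul_right _ hcard).trans ?_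
    rw [← smul_eq_mul, ← Finset.card_univ]
    exact Finset.card_nsmul_le_sum _ _ _ fun x _ => ih _ x.2

/-- An alternating form vanishing at a linearly independent family vanishes at every family of the
same length in its span. -/
theorem AlternatingMap.eq_zero_of_mem_span {K M : Type*} [Field K] [AddCommGroup M] [Module K M]
    {n : ℕ} (f : M [⋀^Fin n]→ₗ[K] K) {v w : Fin n → M} (hli : LinearIndependent K v)
    (hv : f v = 0) (hw : ∀ i, w i ∈ Submodule.span K (Set.range v)) : f w = 0 := by
  have h : f.compLinearMap (Submodule.span K (Set.range v)).subtype = 0 := by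
    rw [← AlternatingMap.map_basis_eq_zero_iff (Basis.span hli)]
    simpa [Function.comp_def, Basis.span_apply] using hv
  exact DFunLike.congr_fun h fun i => ⟨w i, hw i⟩

/-- Double counting of bases of the subspaces on which an alternating form vanishes. -/
theorem AlternatingMap.card_mul_add_card_ne_zero_le {K M : Type*} [Field K] [Fintype K]
    [AddCommGroup M] [Module K M] [FiniteDimensional K M] {n : ℕ} (hn : n ≤ finrank K M)
    (f : M [⋀^Fin n]→ₗ[K] K) (S : Set (Submodule K M))
    (hS : ∀ L ∈ S, finrank K L = n ∧ ∀ w : Fin n → M, (∀ i, w i ∈ L) → f w = 0) :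
    Nat.card S * ∏ i : Fin n, (Fintype.card K ^ n - Fintype.card K ^ i.val) +
      Nat.card {v : Fin n → M // f v ≠ 0} ≤
        ∏ i : Fin n, (Fintype.card K ^ finrank K M - Fintype.card K ^ i.val) := by
  have : Finite M := Module.finite_of_finite K
  have := Fintype.ofFinite S
  have hsigma : Nat.card (Σ L : S, {s : Fin n → L.1 // LinearIndependent K s}) =
      Nat.card S * ∏ i : Fin n, (Fintype.card K ^ n - Fintype.card K ^ i.val) := by
    rw [Nat.card_sigma, Finset.sum_congr rfl fun L _ => ?_, Finset.sum_const, Finset.card_univ,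
      smul_eq_mul, Nat.card_eq_fintype_card]
    rw [card_linearIndependent (hS L.1 L.2).1.ge, (hS L.1 L.2).1]
  rw [← hsigma, ← card_linearIndependent hn, ← Nat.card_sum]
  let g : (Σ L : S, {s : Fin n → L.1 // LinearIndependent K s}) ⊕ {v : Fin n → M // f v ≠ 0} →
      {s : Fin n → M // LinearIndependent K s} :=
    Sum.elim (fun p => ⟨p.1.1.subtype ∘ p.2.1, p.2.2.map' _ (Submodule.ker_subtype _)⟩)
      fun v => ⟨v.1, by_contra fun h => v.2 (f.map_linearDependent v.1 h)⟩
  refine Nat.card_le_card_of_injective g (Function.Injective.sumElim ?_ ?_ ?_)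
  · rintro ⟨⟨L, hL⟩, s, hs⟩ ⟨⟨L', hL'⟩, s', hs'⟩ h
    have h : L.subtype ∘ s = L'.subtype ∘ s' := congrArg Subtype.val h
    have span_eq : ∀ (L : Submodule K M) (_ : L ∈ S) (s : Fin n → L), LinearIndependent K s →
        Submodule.span K (Set.range (L.subtype ∘ s)) = L := by
      intro L hL s hs
      rw [Set.range_comp, Submodule.span_image,
        hs.span_eq_top_of_card_eq_finrank' (by simp [(hS L hL).1]), Submodule.map_subtype_top]
    obtain rfl : L = L' := by rw [← span_eq L hL s hs, h, span_eq L' hL' s' hs']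
    obtain rfl : s = s' := L.injective_subtype.comp_left h
    rfl
  · intro v w h
    exact Subtype.ext (congrArg Subtype.val h :)
  · rintro ⟨⟨L, hL⟩, s, hs⟩ v h
    have h : L.subtype ∘ s = v.1 := congrArg Subtype.val h
    exact v.2 (h ▸ (hS L hL).2 _ fun i => (s i).2)

theorem gaussBinom_mul_prod {q m l : ℕ} (hq : 1 < q) (hlm : l ≤ m) :
    gaussBinom q m l * ∏ i ∈ Finset.range l, ((q : ℚ) ^ l - (q : ℚ) ^ i) =
      ∏ i ∈ Finset.range l, ((q : ℚ) ^ m - (q : ℚ) ^ i) := by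
  have hq' : (1 : ℚ) < q := by exact_mod_cast hq
  have split : ∀ n, l ≤ n → ∏ i ∈ Finset.range l, ((q : ℚ) ^ n - (q : ℚ) ^ i) =
      (∏ i ∈ Finset.range l, (q : ℚ) ^ i) * ∏ i ∈ Finset.range l, ((q : ℚ) ^ (n - i) - 1) := by
    intro n hn
    rw [← Finset.prod_mul_distrib]
    refine Finset.prod_congr rfl fun i hi => ?_
    rw [mul_sub, mul_one, ← pow_add, Nat.add_sub_cancel' (by grind)]
  have reflect : ∏ i ∈ Finset.range l, ((q : ℚ) ^ (l - i) - 1) =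
      ∏ i ∈ Finset.range l, ((q : ℚ) ^ (i + 1) - 1) := by
    rw [← Finset.prod_range_reflect]
    refine Finset.prod_congr rfl fun i hi => ?_
    congr 2
    grind
  have hne : ∏ i ∈ Finset.range l, ((q : ℚ) ^ (i + 1) - 1) ≠ 0 :=
    Finset.prod_ne_zero_iff.2 fun i _ => (sub_pos.2 (one_lt_pow₀ hq' i.succ_ne_zero)).ne'
  rw [split l le_rfl, split m hlm, reflect, gaussBinom, Finset.prod_div_distrib]
  field_simp

theorem pow_mul_prod_pow_sub {q m l : ℕ} (hlm : l ≤ m) :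
    (q : ℚ) ^ (l * (m - l)) * ∏ i ∈ Finset.range l, ((q : ℚ) ^ l - (q : ℚ) ^ i) =
      ∏ j ∈ Finset.range l, ((q : ℚ) ^ m - (q : ℚ) ^ (m - (j + 1))) := by
  rw [← Finset.prod_range_reflect, mul_comm l, pow_mul, ← Finset.card_range l,
    ← Finset.prod_const, Finset.card_range, ← Finset.prod_mul_distrib]
  refine Finset.prod_congr rfl fun i hi => ?_
  have hi := Finset.mem_range.1 hi
  rw [mul_sub, ← pow_add, ← pow_add]
  congr 2 <;> omega

/-- **Nogin's theorem (bound).** If `1 ≤ ℓ ≤ m` and `Π` is a hyperplane of the Plücker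
projective space `P(⋀^ℓ V)`, then `|Π ∩ G(ℓ,V)| ≤ [m ℓ]_q − q^{ℓ(m−ℓ)}`. -/
theorem stmt0 (F : Type*) [Field F] [Fintype F] (V : Type*) [AddCommGroup V] [Module F V]
    [FiniteDimensional F V] (q m l : ℕ) (hq : Fintype.card F = q)
    (hV : finrank F V = m) (hl : 1 ≤ l) (hlm : l ≤ m)
    (φ : ⋀[F]^l V →ₗ[F] F) (hφ : φ ≠ 0) :
    (Nat.card {L : Submodule F V | finrank F L = l ∧ LiesOn F V l φ L} : ℚ) ≤
      eG q l m := by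
  subst hq hV
  set f : V [⋀^Fin l]→ₗ[F] F := φ.compAlternatingMap (exteriorPower.ιMulti F l) with hf_def
  have hf : f ≠ 0 := fun h => hφ (exteriorPower.linearMap_ext (by simpa using h))
  have h1 := f.prod_le_card_ne_zero hf
  have h2 := f.card_mul_add_card_ne_zero_le hlm {L | finrank F L = l ∧ LiesOn F V l φ L} (by
    rintro L ⟨hL, ω, -, hli, hspan, hω⟩
    exact ⟨hL, fun w hw => f.eq_zero_of_mem_span hli hω fun i => hspan ▸ hw i⟩)
  have hq : 1 < Fintype.card F := Fintype.one_lt_card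
  rw [Finset.prod_range fun i => _] at h1
  have h3 := (Nat.add_le_add_left h1 _).trans h2
  rw [← Finset.prod_range fun i => Fintype.card F ^ l - Fintype.card F ^ i,
    ← Finset.prod_range fun i => Fintype.card F ^ finrank F V -
      Fintype.card F ^ (finrank F V - (i + 1)),
    ← Finset.prod_range fun i => Fintype.card F ^ finrank F V - Fintype.card F ^ i] at h3
  have cast_prod : ∀ (n : ℕ) (e : ℕ → ℕ), (∀ i < l, e i ≤ n) →
      ((∏ i ∈ Finset.range l, (Fintype.card F ^ n - Fintype.card F ^ e i) : ℕ) : ℚ) =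
        ∏ i ∈ Finset.range l, ((Fintype.card F : ℚ) ^ n - (Fintype.card F : ℚ) ^ e i) := by
    intro n e he
    rw [Nat.cast_prod]
    refine Finset.prod_congr rfl fun i hi => ?_
    rw [Nat.cast_sub (Nat.pow_le_pow_right hq.le (he i (Finset.mem_range.1 hi)))]
    simp
  have h4 := (Nat.cast_le (α := ℚ)).2 h3
  rw [Nat.cast_add, Nat.cast_mul, cast_prod _ (fun i => i) (fun i hi => hi.le),
    cast_prod _ (fun i => finrank F V - (i + 1)) (fun i _ => Nat.sub_le _ _),
    cast_prod _ (fun i => i) (fun i hi => hi.le.trans hlm), ← gaussBinom_mul_prod hq hlm,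
    ← pow_mul_prod_pow_sub hlm, ← add_mul] at h4
  have hpos : 0 < ∏ i ∈ Finset.range l, ((Fintype.card F : ℚ) ^ l - (Fintype.card F : ℚ) ^ i) :=
    Finset.prod_pos fun i hi => sub_pos.2
      (pow_lt_pow_right₀ (by exact_mod_cast hq) (Finset.mem_range.1 hi))
  exact le_sub_iff_add_le.2 (le_of_mul_le_mul_right h4 hpos)
end

section
/- Let 1 ≤ ℓ ≤ m and let Π be a hyperplane of the Plücker projective space P(⋀^ℓ V). Then |Π ∩ G(ℓ,V)| = [m ℓ]_q − q^{ℓ(m−ℓ)} if and only if Π is decomposable. -/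
open Module

variable (F : Type*) [Field F] (V : Type*) [AddCommGroup V] [Module F V]

section Radical

variable {F V} {n : ℕ}

/-- `f` vanishes on every tuple having an entry in `W`. -/
def VanishesOn (f : V [⋀^Fin n]→ₗ[F] F) (W : Submodule F V) : Prop :=
  ∀ (ω : Fin n → V) (i : Fin n), ω i ∈ W → f ω = 0

lemma vanishesOn_ker_curryLeft (f : V [⋀^Fin (n + 1)]→ₗ[F] F) :
    VanishesOn f (LinearMap.ker f.curryLeft) := by
  intro ω i hi
  have h0 : f (ω ∘ Equiv.swap 0 i) = 0 := by
    have h := congrArg (fun g => g (Matrix.vecTail (ω ∘ Equiv.swap 0 i))) (LinearMap.mem_ker.1 hi)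
    simp only [AlternatingMap.curryLeft_apply_apply, AlternatingMap.zero_apply] at h
    rw [← h]
    congr 1
    conv_lhs => rw [← Matrix.cons_head_tail (ω ∘ Equiv.swap 0 i)]
    simp [Matrix.vecHead]
  rw [f.map_perm] at h0
  rcases Int.units_eq_one_or (Equiv.Perm.sign (Equiv.swap 0 i)) with h | h <;> simpa [h] using h0

lemma VanishesOn.disjoint_span {f : V [⋀^Fin n]→ₗ[F] F} {W : Submodule F V}
    (hW : VanishesOn f W) {ω : Fin n → V} (hω : f ω ≠ 0) :
    Disjoint W (Submodule.span F (Set.range ω)) := by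
  rw [Submodule.disjoint_def]
  intro x hxW hx
  obtain ⟨c, rfl⟩ := (Submodule.mem_span_range_iff_exists_fun F).1 hx
  refine Finset.sum_eq_zero fun i _ => ?_
  have h := hW (Function.update ω i (∑ j, c j • ω j)) i (by simpa using hxW)
  rw [f.map_update_sum, Finset.sum_eq_single i] at h
  · rw [f.map_update_smul, Function.update_eq_self, smul_eq_zero] at h
    simp [h.resolve_right hω]
  · intro j _ hj
    rw [f.map_update_smul, f.map_update_self _ hj.symm, smul_zero]
  · simp

lemma linearIndependent_of_map_ne_zero {f : V [⋀^Fin n]→ₗ[F] F} {ω : Fin n → V}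
    (hω : f ω ≠ 0) : LinearIndependent F ω := by
  by_contra h
  exact hω (f.map_linearDependent ω h)

lemma VanishesOn.finrank_add_le [FiniteDimensional F V] {f : V [⋀^Fin n]→ₗ[F] F}
    {W : Submodule F V} (hW : VanishesOn f W) (hf : f ≠ 0) : finrank F W + n ≤ finrank F V := by
  obtain ⟨ω, hω⟩ : ∃ ω, f ω ≠ 0 := by
    by_contra! h
    exact hf (AlternatingMap.ext h)
  have h := Submodule.finrank_add_finrank_le_of_disjoint (hW.disjoint_span hω)
  rwa [finrank_span_eq_card (linearIndependent_of_map_ne_zero hω), Fintype.card_fin] at h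

lemma VanishesOn.curryLeft {f : V [⋀^Fin (n + 1)]→ₗ[F] F} {W : Submodule F V}
    (hW : VanishesOn f W) (v : V) :
    VanishesOn (f.curryLeft v) (W ⊔ Submodule.span F {v}) := by
  intro ω i hi
  obtain ⟨w, hw, u, hu, hwu⟩ := Submodule.mem_sup.1 hi
  obtain ⟨c, rfl⟩ := Submodule.mem_span_singleton.1 hu
  rw [← Function.update_eq_self i ω, ← hwu, AlternatingMap.map_update_add,
    AlternatingMap.map_update_smul]
  have h1 : f.curryLeft v (Function.update ω i w) = 0 :=
    hW _ i.succ (by simpa using hw)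
  have h2 : f.curryLeft v (Function.update ω i v) = 0 :=
    f.map_eq_zero_of_eq _ (i := 0) (j := i.succ) (by simp) (Fin.succ_ne_zero i).symm
  simp [h1, h2]

lemma VanishesOn.le_ker_curryLeft {f : V [⋀^Fin (n + 1)]→ₗ[F] F} {W : Submodule F V}
    (hW : VanishesOn f W) : W ≤ LinearMap.ker f.curryLeft := fun _ hw =>
  LinearMap.mem_ker.2 <| AlternatingMap.ext fun _ => hW _ 0 (by simpa using hw)

end Radical

section Support

variable {F V} {n : ℕ}

/-- The number of tuples at which an alternating form does not vanish. -/
noncomputable def supportCard (f : V [⋀^Fin n]→ₗ[F] F) : ℕ := Nat.card {ω // f ω ≠ 0}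

/-- The number of tuples at which a nonzero decomposable alternating form does not vanish. -/
def minSupport (q m n : ℕ) : ℕ := ∏ i ∈ Finset.range n, (q ^ m - q ^ (m - 1 - i))

lemma minSupport_succ (q m n : ℕ) :
    minSupport q m (n + 1) = (q ^ m - q ^ (m - (n + 1))) * minSupport q m n := by
  rw [minSupport, Finset.prod_range_succ, mul_comm, minSupport, Nat.sub_sub, add_comm 1 n]

lemma minSupport_pos {q m n : ℕ} (hq : 1 < q) (h : n ≤ m) : 0 < minSupport q m n := by
  refine Finset.prod_pos fun i hi => Nat.sub_pos_of_lt (Nat.pow_lt_pow_right hq ?_)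
  have := Finset.mem_range.1 hi
  omega

@[simp] lemma supportCard_zero : supportCard (0 : V [⋀^Fin n]→ₗ[F] F) = 0 := by
  simp [supportCard]

lemma supportCard_of_isEmpty (f : V [⋀^Fin 0]→ₗ[F] F) (hf : f ≠ 0) : supportCard f = 1 := by
  have h : ∀ ω, f ω ≠ 0 := fun ω h =>
    hf (AlternatingMap.ext fun ω' => by rw [Subsingleton.elim ω' ω, h, AlternatingMap.zero_apply])
  simp [supportCard, h]

variable [Fintype V]

lemma supportCard_succ (f : V [⋀^Fin (n + 1)]→ₗ[F] F) :
    supportCard f = ∑ v, supportCard (f.curryLeft v) := by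
  simp only [supportCard]
  rw [← Nat.card_sigma]
  refine Nat.card_congr (Equiv.trans ?_ (Equiv.subtypeProdEquivSigmaSubtype
    fun v ω => f.curryLeft v ω ≠ 0))
  exact (Equiv.subtypeEquiv (Fin.consEquiv fun _ => V) fun a => Iff.rfl).symm

lemma supportCard_eq_sum_compl (f : V [⋀^Fin (n + 1)]→ₗ[F] F) (W : Submodule F V)
    (hW : W ≤ LinearMap.ker f.curryLeft) [DecidablePred (· ∈ W)] :
    supportCard f = ∑ v with v ∉ W, supportCard (f.curryLeft v) := by
  rw [supportCard_succ, Finset.sum_filter]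
  refine Finset.sum_congr rfl fun v _ => ?_
  split_ifs with h
  · rw [LinearMap.mem_ker.1 (hW h), supportCard_zero]
  · rfl

variable [Fintype F]

lemma card_compl_submodule (W : Submodule F V) [DecidablePred (· ∈ W)] :
    (Finset.univ.filter (· ∉ W)).card
      = Fintype.card F ^ finrank F V - Fintype.card F ^ finrank F W := by
  classical
  rw [Finset.filter_not, Finset.card_sdiff_of_subset (Finset.filter_subset _ _), Finset.card_univ,
    Module.card_eq_pow_finrank (K := F) (V := V), ← Module.card_eq_pow_finrank (K := F) (V := W),
    Fintype.card_subtype]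

open Classical in
lemma ker_mul_minSupport_le (f : V [⋀^Fin (n + 1)]→ₗ[F] F)
    (ih : ∀ g : V [⋀^Fin n]→ₗ[F] F, g ≠ 0 →
      minSupport (Fintype.card F) (finrank F V) n ≤ supportCard g) :
    (Fintype.card F ^ finrank F V - Fintype.card F ^ finrank F (LinearMap.ker f.curryLeft)) *
      minSupport (Fintype.card F) (finrank F V) n ≤ supportCard f := by
  rw [supportCard_eq_sum_compl f _ le_rfl, ← card_compl_submodule, ← smul_eq_mul]
  refine Finset.card_nsmul_le_sum _ _ _ fun v hv => ih _ ?_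
  simpa using hv

lemma minSupport_le_supportCard (f : V [⋀^Fin n]→ₗ[F] F) (hf : f ≠ 0) :
    minSupport (Fintype.card F) (finrank F V) n ≤ supportCard f := by
  induction n with
  | zero => simp [minSupport, supportCard_of_isEmpty f hf]
  | succ n ih =>
    refine le_trans ?_ (ker_mul_minSupport_le f ih)
    rw [minSupport_succ]
    have := (vanishesOn_ker_curryLeft f).finrank_add_le hf
    gcongr
    · exact Fintype.card_pos
    · omega

lemma finrank_ker_of_supportCard_eq (f : V [⋀^Fin (n + 1)]→ₗ[F] F) (hf : f ≠ 0)
    (h : supportCard f = minSupport (Fintype.card F) (finrank F V) (n + 1)) :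
    finrank F (LinearMap.ker f.curryLeft) + (n + 1) = finrank F V := by
  have hle := (vanishesOn_ker_curryLeft f).finrank_add_le hf
  by_contra hne
  have hlt : finrank F (LinearMap.ker f.curryLeft) < finrank F V - (n + 1) := by omega
  have h1 := ker_mul_minSupport_le f minSupport_le_supportCard
  have hq : 1 < Fintype.card F := Fintype.one_lt_card
  rw [h, minSupport_succ] at h1
  have h2 := Nat.le_of_mul_le_mul_right h1 (minSupport_pos hq (by omega))
  have h3 := Nat.pow_lt_pow_right hq hlt
  have h4 : Fintype.card F ^ (finrank F V - (n + 1)) ≤ Fintype.card F ^ finrank F V :=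
    Nat.pow_le_pow_right hq.le (Nat.sub_le _ _)
  omega

open Classical in
lemma VanishesOn.supportCard_eq {f : V [⋀^Fin n]→ₗ[F] F} (hf : f ≠ 0) {W : Submodule F V}
    (hW : VanishesOn f W) (hdim : finrank F W + n = finrank F V) :
    supportCard f = minSupport (Fintype.card F) (finrank F V) n := by
  induction n generalizing W with
  | zero => simp [minSupport, supportCard_of_isEmpty f hf]
  | succ n ih =>
    have hker : LinearMap.ker f.curryLeft = W := by
      refine (Submodule.eq_of_le_of_finrank_le hW.le_ker_curryLeft ?_).symm
      have := (vanishesOn_ker_curryLeft f).finrank_add_le hf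
      omega
    rw [supportCard_eq_sum_compl f W hker.ge, Finset.sum_eq_card_nsmul
      (b := minSupport (Fintype.card F) (finrank F V) n), card_compl_submodule, minSupport_succ,
      smul_eq_mul, ← hdim, Nat.add_sub_cancel]
    intro v hv
    have hv : v ∉ W := by simpa using hv
    have hne : f.curryLeft v ≠ 0 := by rwa [← hker, LinearMap.mem_ker] at hv
    refine ih hne (hW.curryLeft v) ?_
    have h1 := (hW.curryLeft v).finrank_add_le hne
    have h2 : finrank F W < finrank F (W ⊔ Submodule.span F {v} : Submodule F V) :=
      Submodule.finrank_lt_finrank_of_lt <| lt_of_le_of_ne le_sup_left fun h =>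
        hv (h ▸ Submodule.mem_sup_right (Submodule.mem_span_singleton_self v))
    omega

end Support

section Counting

/-- The number of ordered bases of an `n`-dimensional space over a field with `q` elements. -/
def orderedBases (q n : ℕ) : ℕ := ∏ i : Fin n, (q ^ n - q ^ i.val)

lemma orderedBases_pos {q : ℕ} (hq : 1 < q) (n : ℕ) : 0 < orderedBases q n :=
  Finset.prod_pos fun i _ => Nat.sub_pos_of_lt (Nat.pow_lt_pow_right hq i.2)

lemma minSupport_eq (q : ℕ) {m n : ℕ} (h : n ≤ m) :
    minSupport q m n = orderedBases q n * q ^ (n * (m - n)) := by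
  rw [minSupport, orderedBases, Fin.prod_univ_eq_prod_range (fun i => q ^ n - q ^ i),
    ← Finset.prod_range_reflect, mul_comm n, pow_mul,
    show (q ^ (m - n)) ^ n = ∏ _i ∈ Finset.range n, q ^ (m - n) by simp,
    ← Finset.prod_mul_distrib]
  refine Finset.prod_congr rfl fun i hi => ?_
  have hi := Finset.mem_range.1 hi
  rw [Nat.sub_mul, ← pow_add, ← pow_add]
  congr 2 <;> omega

lemma gaussBinom_eq {q : ℕ} (hq : 1 < q) {m n : ℕ} (h : n ≤ m) :
    gaussBinom q m n = ((∏ i : Fin n, (q ^ m - q ^ i.val) : ℕ) : ℚ) / orderedBases q n := by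
  have hfactor : ∀ k, n ≤ k → ((∏ i : Fin n, (q ^ k - q ^ i.val) : ℕ) : ℚ) =
      (∏ i ∈ Finset.range n, (q : ℚ) ^ i) * ∏ i ∈ Finset.range n, ((q : ℚ) ^ (k - i) - 1) := by
    intro k hk
    rw [Fin.prod_univ_eq_prod_range (fun i => q ^ k - q ^ i), Nat.cast_prod,
      ← Finset.prod_mul_distrib]
    refine Finset.prod_congr rfl fun i hi => ?_
    have hi := Finset.mem_range.1 hi
    rw [Nat.cast_sub (Nat.pow_le_pow_right hq.le (by omega)), mul_sub, ← pow_add,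
      Nat.add_sub_cancel' (by omega)]
    simp
  have hreflect : ∏ i ∈ Finset.range n, ((q : ℚ) ^ (i + 1) - 1) =
      ∏ i ∈ Finset.range n, ((q : ℚ) ^ (n - i) - 1) := by
    rw [← Finset.prod_range_reflect]
    refine Finset.prod_congr rfl fun i hi => ?_
    have hi := Finset.mem_range.1 hi
    congr 2
    omega
  have hne : ∏ i ∈ Finset.range n, (q : ℚ) ^ i ≠ 0 :=
    Finset.prod_ne_zero_iff.2 fun i _ => pow_ne_zero _ (by exact_mod_cast (by omega : q ≠ 0))
  rw [orderedBases, hfactor m h, hfactor n le_rfl, mul_div_mul_left _ _ hne, gaussBinom,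
    Finset.prod_div_distrib, hreflect]

variable {F V} {n : ℕ}

lemma map_eq_zero_of_span_eq (f : V [⋀^Fin n]→ₗ[F] F) {ω ω' : Fin n → V}
    (hω : LinearIndependent F ω) (hω' : LinearIndependent F ω')
    (h : Submodule.span F (Set.range ω) = Submodule.span F (Set.range ω')) (h0 : f ω = 0) :
    f ω' = 0 := by
  let b := (Basis.span hω).map (LinearEquiv.ofEq _ _ h)
  let b' := Basis.span hω'
  let g := f.compLinearMap (Submodule.span F (Set.range ω')).subtype
  have hb : g b = f ω := by
    simp only [g, AlternatingMap.compLinearMap_apply]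
    congr 1
    ext i
    simp [b, Basis.span_apply]
  have hb' : g b' = f ω' := by
    simp only [g, AlternatingMap.compLinearMap_apply]
    congr 1
    ext i
    simp [b', Basis.span_apply]
  rw [← hb', (g.map_basis_eq_zero_iff b').2 ((g.map_basis_eq_zero_iff b).1 (hb.trans h0))]

/-- The alternating form corresponding to a functional on the exterior power. -/
noncomputable def toForm (φ : ⋀[F]^n V →ₗ[F] F) : V [⋀^Fin n]→ₗ[F] F :=
  φ.compAlternatingMap (exteriorPower.ιMulti F n)

lemma toForm_apply (φ : ⋀[F]^n V →ₗ[F] F) (ω : Fin n → V) : toForm φ ω = φ (wedge F V n ω) := rfl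

lemma toForm_injective : Function.Injective (toForm : (⋀[F]^n V →ₗ[F] F) → _) :=
  fun _ _ h => exteriorPower.linearMap_ext h

lemma toForm_ne_zero {φ : ⋀[F]^n V →ₗ[F] F} (hφ : φ ≠ 0) : toForm φ ≠ 0 := fun h =>
  hφ (toForm_injective (h.trans (by ext; simp [toForm])))

lemma span_range_subtype_val {L : Submodule F V} [FiniteDimensional F L] (hL : finrank F L = n)
    {s : Fin n → L} (hs : LinearIndependent F s) :
    Submodule.span F (Set.range fun i => (s i : V)) = L := by
  have h := hs.span_eq_top_of_card_eq_finrank' (by simp [hL])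
  have hmap := congrArg (Submodule.map L.subtype) h
  rwa [Submodule.map_span, ← Set.range_comp, Submodule.map_top, Submodule.range_subtype] at hmap

/-- The ordered bases of `L`, as tuples of vectors of `V` killed by `φ`, when `L` lies on the
hyperplane determined by `φ`. -/
noncomputable def fiberEquiv [FiniteDimensional F V] (φ : ⋀[F]^n V →ₗ[F] F)
    (L : {L : Submodule F V // finrank F L = n ∧ LiesOn F V n φ L}) :
    {x : {ω : Fin n → V // LinearIndependent F ω ∧ toForm φ ω = 0} //
      Submodule.span F (Set.range x.1) = L.1} ≃ {s : Fin n → L.1 // LinearIndependent F s} where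
  toFun x := ⟨fun i => ⟨x.1.1 i, x.2.le (Submodule.subset_span (Set.mem_range_self i))⟩,
    LinearIndependent.of_comp L.1.subtype x.1.2.1⟩
  invFun s := ⟨⟨fun i => s.1 i, by
    have hs : LinearIndependent F fun i => (s.1 i : V) :=
      s.2.map' L.1.subtype (Submodule.ker_subtype _)
    refine ⟨hs, ?_⟩
    obtain ⟨ω, -, hω, hspan, h0⟩ := L.2.2
    exact map_eq_zero_of_span_eq _ hω hs
      (hspan.trans (span_range_subtype_val L.2.1 s.2).symm) h0⟩, span_range_subtype_val L.2.1 s.2⟩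
  left_inv _ := rfl
  right_inv _ := rfl

lemma finrank_span_eq_and_liesOn (φ : ⋀[F]^n V →ₗ[F] F) {ω : Fin n → V}
    (hω : LinearIndependent F ω) (h0 : toForm φ ω = 0) :
    finrank F (Submodule.span F (Set.range ω)) = n ∧
      LiesOn F V n φ (Submodule.span F (Set.range ω)) :=
  ⟨by rw [finrank_span_eq_card hω, Fintype.card_fin],
    ω, fun i => Submodule.subset_span (Set.mem_range_self i), hω, rfl, h0⟩

variable [Fintype F]

lemma card_liesOn_mul [FiniteDimensional F V] (φ : ⋀[F]^n V →ₗ[F] F) :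
    Nat.card {L : Submodule F V | finrank F L = n ∧ LiesOn F V n φ L} *
      orderedBases (Fintype.card F) n =
    Nat.card {ω : Fin n → V // LinearIndependent F ω ∧ toForm φ ω = 0} := by
  have : Finite V := Module.finite_of_finite F
  have : Finite (Submodule F V) := inferInstance
  let P := {L : Submodule F V // finrank F L = n ∧ LiesOn F V n φ L}
  let : Fintype P := Fintype.ofFinite P
  let span : {ω : Fin n → V // LinearIndependent F ω ∧ toForm φ ω = 0} → P := fun x =>
    ⟨Submodule.span F (Set.range x.1), finrank_span_eq_and_liesOn φ x.2.1 x.2.2⟩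
  rw [← Nat.card_congr (Equiv.sigmaFiberEquiv span), Nat.card_sigma]
  have hfiber : ∀ L : P, Nat.card {x // span x = L} = orderedBases (Fintype.card F) n := by
    intro L
    have hL : finrank F L.1 = n := L.2.1
    rw [Nat.card_congr ((Equiv.subtypeEquivRight fun x => Subtype.ext_iff).trans
      (fiberEquiv φ L)), card_linearIndependent hL.ge, hL, orderedBases]
  rw [Finset.sum_congr rfl fun L _ => hfiber L, Finset.sum_const, smul_eq_mul, Finset.card_univ,
    ← Nat.card_eq_fintype_card (α := P)]
  rfl

lemma card_add_supportCard [Finite V] (f : V [⋀^Fin n]→ₗ[F] F) (hn : n ≤ finrank F V) :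
    Nat.card {ω : Fin n → V // LinearIndependent F ω ∧ f ω = 0} + supportCard f =
      ∏ i : Fin n, (Fintype.card F ^ finrank F V - Fintype.card F ^ i.val) := by
  classical
  rw [← card_linearIndependent hn, supportCard, ← Nat.card_sum]
  refine Nat.card_congr (Equiv.trans (Equiv.sumCongr ?_ ?_)
    (Equiv.sumCompl fun ω : {ω : Fin n → V // LinearIndependent F ω} => f ω = 0))
  · exact (Equiv.subtypeSubtypeEquivSubtypeInter _ fun ω => f ω = 0).symm
  · exact (Equiv.subtypeSubtypeEquivSubtype (q := fun ω => ¬ f ω = 0)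
      fun h => linearIndependent_of_map_ne_zero h).symm

lemma card_liesOn_eq_eG_iff [FiniteDimensional F V] (φ : ⋀[F]^n V →ₗ[F] F)
    (hn : n ≤ finrank F V) :
    (Nat.card {L : Submodule F V | finrank F L = n ∧ LiesOn F V n φ L} : ℚ) =
      eG (Fintype.card F) n (finrank F V) ↔
    supportCard (toForm φ) = minSupport (Fintype.card F) (finrank F V) n := by
  have : Finite V := Module.finite_of_finite F
  have hq : 1 < Fintype.card F := Fintype.one_lt_card
  have hpos : (0 : ℚ) < orderedBases (Fintype.card F) n := by
    exact_mod_cast orderedBases_pos hq n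
  rw [eG, gaussBinom_eq hq hn, ← card_add_supportCard (toForm φ) hn, ← card_liesOn_mul,
    minSupport_eq _ hn, ← Nat.cast_inj (R := ℚ), eq_sub_iff_add_eq, eq_div_iff hpos.ne']
  push_cast
  constructor <;> intro h <;> linarith

end Counting

section Decomposable

variable {F V}

/-- `mulWedge` as a linear map. -/
noncomputable def mulWedgeLinear (k l n : ℕ) (h : k + l = n) (w : Fin k → V) :
    ⋀[F]^l V →ₗ[F] ⋀[F]^n V where
  toFun := mulWedge F V k l n h w
  map_add' x y := Subtype.ext (by simp [mulWedge, mul_add])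
  map_smul' c x := Subtype.ext (by simp [mulWedge])

lemma mulWedge_wedge (k l n : ℕ) (h : k + l = n) (w : Fin k → V) (ω : Fin l → V) :
    mulWedge F V k l n h w (wedge F V l ω) = wedge F V n (Fin.append w ω ∘ Fin.cast h.symm) := by
  subst h
  exact Subtype.ext (ExteriorAlgebra.ιMulti_mul_ιMulti w ω)

lemma toForm_apply_eq_zero {n : ℕ} (ψ : ⋀[F]^n V →ₗ[F] F) {k l : ℕ} (h : k + l = n)
    (w : Fin k → V) (ω : Fin l → V) {i : Fin l} {j : Fin k} (hij : ω i = w j) :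
    toForm ψ (Fin.append w ω ∘ Fin.cast h.symm) = 0 := by
  subst h
  refine (toForm ψ).map_eq_zero_of_eq _ (i := Fin.natAdd k i) (j := Fin.castAdd l j) ?_ ?_
  · simpa using hij
  · intro h
    have := congrArg Fin.val h
    simp at this
    omega

lemma IsDecomposable.exists_vanishesOn {l : ℕ} (hl : l ≤ finrank F V) {φ : ⋀[F]^l V →ₗ[F] F}
    (hφ : φ ≠ 0) (h : IsDecomposable F V (finrank F V) l hl φ) :
    ∃ W : Submodule F V, VanishesOn (toForm φ) W ∧ finrank F W + l = finrank F V := by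
  obtain ⟨w, ψ, -, hψ⟩ := h
  have hform : ∀ ω, toForm φ ω =
      toForm ψ (Fin.append w ω ∘ Fin.cast (Nat.sub_add_cancel hl).symm) := fun ω => by
    rw [toForm_apply, hψ, mulWedge_wedge, toForm_apply]
  refine ⟨Submodule.span F (Set.range w), ?_, ?_⟩
  · cases l with
    | zero => exact fun _ i => i.elim0
    | succ l =>
      have hle : Submodule.span F (Set.range w) ≤ LinearMap.ker (toForm φ).curryLeft := by
        rw [Submodule.span_le]
        rintro _ ⟨j, rfl⟩
        refine LinearMap.mem_ker.2 (AlternatingMap.ext fun ω => ?_)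
        exact (hform _).trans
          (toForm_apply_eq_zero ψ (Nat.sub_add_cancel hl) w _ (i := 0) (j := j) rfl)
      exact fun ω i hi => vanishesOn_ker_curryLeft _ ω i (hle hi)
  · obtain ⟨ω, hω⟩ : ∃ ω, toForm φ ω ≠ 0 := by
      by_contra! h
      exact toForm_ne_zero hφ (AlternatingMap.ext h)
    rw [hform] at hω
    have hw : LinearIndependent F w := by
      convert (linearIndependent_of_map_ne_zero hω).comp
        (fun i : Fin (finrank F V - l) => Fin.cast (Nat.sub_add_cancel hl) (Fin.castAdd l i))
        (fun i j h => by simpa using h) using 1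
      ext i
      simp
    rw [finrank_span_eq_card hw, Fintype.card_fin, Nat.sub_add_cancel hl]

lemma VanishesOn.isDecomposable [FiniteDimensional F V] {l : ℕ} (hl : l ≤ finrank F V)
    {φ : ⋀[F]^l V →ₗ[F] F} (hφ : φ ≠ 0) {W : Submodule F V} (hW : VanishesOn (toForm φ) W)
    (hdim : finrank F W + l = finrank F V) : IsDecomposable F V (finrank F V) l hl φ := by
  obtain ⟨ω, hω⟩ : ∃ ω, toForm φ ω ≠ 0 := by
    by_contra! h
    exact toForm_ne_zero hφ (AlternatingMap.ext h)
  let bW : Basis (Fin (finrank F V - l)) F W := finBasisOfFinrankEq F W (by omega)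
  let w : Fin (finrank F V - l) → V := fun i => bW i
  have hw : LinearIndependent F w := bW.linearIndependent.map' W.subtype (Submodule.ker_subtype W)
  have hdisj : Disjoint (Submodule.span F (Set.range w)) (Submodule.span F (Set.range ω)) :=
    (hW.disjoint_span hω).mono_left <| Submodule.span_le.2 <| by
      rintro _ ⟨i, rfl⟩
      exact (bW i).2
  have hsum : LinearIndependent F (Sum.elim w ω) :=
    hw.sum_type (linearIndependent_of_map_ne_zero hω) hdisj
  let e : Basis (Fin (finrank F V - l) ⊕ Fin l) F V :=
    basisOfLinearIndependentOfCardEqFinrank' _ hsum (by simp [Nat.sub_add_cancel hl])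
  let b : Basis (Fin (finrank F V)) F V :=
    e.reindex (finSumFinEquiv.trans (finCongr (Nat.sub_add_cancel hl)))
  have hb : Fin.append w ω ∘ Fin.cast (Nat.sub_add_cancel hl).symm = b := by
    ext i
    obtain ⟨j, rfl⟩ := (finCongr (Nat.sub_add_cancel hl)).surjective i
    refine Fin.addCases (fun k => ?_) (fun k => ?_) j <;> simp [b, e]
  let ψ : ⋀[F]^(finrank F V) V →ₗ[F] F :=
    exteriorPower.alternatingMapLinearEquiv (toForm φ ω • b.det)
  have hψ : toForm ψ = toForm φ ω • b.det :=
    exteriorPower.alternatingMapLinearEquiv_comp_ιMulti _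
  let χ := ψ ∘ₗ mulWedgeLinear (finrank F V - l) l (finrank F V) (Nat.sub_add_cancel hl) w
  have hχ : ∀ u, toForm χ u =
      toForm ψ (Fin.append w u ∘ Fin.cast (Nat.sub_add_cancel hl).symm) := fun u =>
    congrArg ψ (mulWedge_wedge _ _ _ (Nat.sub_add_cancel hl) w u)
  have hχω : toForm χ ω = toForm φ ω := by
    rw [hχ, hb, hψ, AlternatingMap.smul_apply, b.det_self, smul_eq_mul, mul_one]
  refine ⟨w, ψ, ?_, ?_⟩
  · intro h
    refine hω ?_
    rw [← hχω, hχ, h]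
    rfl
  · suffices h : φ = χ from fun x => LinearMap.congr_fun h x
    refine toForm_injective (Basis.ext_alternating e fun v hv => ?_)
    by_cases h : ∃ i j, v i = Sum.inl j
    · obtain ⟨i, j, hij⟩ := h
      have hi : e (v i) = w j := by simp [hij, e]
      rw [hW _ i (by rw [hi]; exact (bW j).2), hχ,
        toForm_apply_eq_zero ψ (Nat.sub_add_cancel hl) w _ hi]
    · have hr : ∀ i, ∃ j, v i = Sum.inr j := by
        intro i
        rcases hvi : v i with j | j
        · exact (h ⟨i, j, hvi⟩).elim
        · exact ⟨j, rfl⟩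
      choose s hs using hr
      have hinj : Function.Injective s := fun i j hij => hv (by rw [hs, hs, hij])
      let σ : Equiv.Perm (Fin l) := Equiv.ofBijective s (Finite.injective_iff_bijective.1 hinj)
      have hv' : (fun i => e (v i)) = ω ∘ σ := by
        ext i
        simp [hs, e, σ]
      rw [hv', AlternatingMap.map_perm, AlternatingMap.map_perm, hχω]

end Decomposable

/-- **Nogin's theorem (equality case).** If `1 ≤ ℓ ≤ m` and `Π` is a hyperplane of the Plücker
projective space `P(⋀^ℓ V)`, then `|Π ∩ G(ℓ,V)| = [m ℓ]_q − q^{ℓ(m−ℓ)}` if and only if `Π` is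
decomposable. -/
theorem stmt1 (F : Type*) [Field F] [Fintype F] (V : Type*) [AddCommGroup V] [Module F V]
    [FiniteDimensional F V] (q m l : ℕ) (hq : Fintype.card F = q)
    (hV : finrank F V = m) (hl : 1 ≤ l) (hlm : l ≤ m)
    (φ : ⋀[F]^l V →ₗ[F] F) (hφ : φ ≠ 0) :
    (Nat.card {L : Submodule F V | finrank F L = l ∧ LiesOn F V l φ L} : ℚ) = eG q l m ↔
      IsDecomposable F V m l hlm φ := by
  subst hq hV
  have : Finite V := Module.finite_of_finite F
  let : Fintype V := Fintype.ofFinite V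
  rw [card_liesOn_eq_eG_iff φ hlm]
  constructor
  · intro h
    obtain ⟨n, rfl⟩ := Nat.exists_eq_add_of_le' hl
    exact (vanishesOn_ker_curryLeft _).isDecomposable hlm hφ
      (finrank_ker_of_supportCard_eq _ (toForm_ne_zero hφ) h)
  · intro h
    obtain ⟨W, hW, hdim⟩ := h.exists_vanishesOn hlm hφ
    exact hW.supportCard_eq (toForm_ne_zero hφ) hdim
end

section
/- Let 2 ≤ ℓ ≤ m−2 and let Π be a hyperplane of the Plücker projective space P(⋀^ℓ V), determined by the nonzero functional φ. If some L ∈ Ω_θ does not lie on Π, then |{L ∈ Ω_θ : L lies on Π}| ≤ n_θ − q^{ℓ(m−ℓ)−2}, where n_θ = |Ω_θ|. -/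
open Module

variable (F : Type*) [Field F] (V : Type*) [AddCommGroup V] [Module F V]

/-- Membership in the Schubert variety `Ω_θ`, where, relative to a complete flag `Vflag` in `V`
(with `dim Vflag i = i`), `θ₁ = m−ℓ−1` and `θ_j = m−ℓ+j` for `j = 2, …, ℓ`:
`L ∈ Ω_θ` iff `dim L = ℓ` and `dim (L ∩ V_{θ_j}) ≥ j` for all `j = 1, …, ℓ`. -/
def InSchubertTheta (m l : ℕ) (Vflag : ℕ → Submodule F V) (L : Submodule F V) : Prop :=
  finrank F L = l ∧ ∀ j : ℕ, 1 ≤ j → j ≤ l →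
    j ≤ finrank F ↥(L ⊓ Vflag (if j = 1 then m - l - 1 else m - l + j))

section AlternatingForms

variable {F V}

open Finset

theorem AlternatingMap.ne_zero_iff_of_perm {ι : Type*} [Fintype ι] [DecidableEq ι]
    (f : V [⋀^ι]→ₗ[F] F) (w : ι → V) (σ : Equiv.Perm ι) : f (w ∘ σ) ≠ 0 ↔ f w ≠ 0 := by
  rw [f.map_perm]
  rcases Int.units_eq_one_or (Equiv.Perm.sign σ) with h | h <;> simp [h]

theorem AlternatingMap.eq_zero_of_curryLeft_eq_zero {r : ℕ} (f : V [⋀^Fin (r + 1)]→ₗ[F] F)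
    (w : Fin (r + 1) → V) (i : Fin (r + 1)) (h : f.curryLeft (w i) = 0) : f w = 0 := by
  by_contra hf
  rw [← ne_eq, ← f.ne_zero_iff_of_perm w (Equiv.swap 0 i)] at hf
  apply hf
  have h1 := DFunLike.congr_fun h (Fin.tail (w ∘ Equiv.swap 0 i))
  rw [AlternatingMap.curryLeft_apply_apply, AlternatingMap.zero_apply] at h1
  convert h1 using 2
  conv_lhs => rw [← Fin.cons_self_tail (w ∘ Equiv.swap 0 i)]
  simp [Matrix.vecCons]

theorem AlternatingMap.eq_zero_of_curryLeft_curryLeft_eq_zero {r : ℕ}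
    (f : V [⋀^Fin (r + 2)]→ₗ[F] F) (w : Fin (r + 2) → V) (i j : Fin (r + 2)) (hij : i ≠ j)
    (h : (f.curryLeft (w i)).curryLeft (w j) = 0) : f w = 0 := by
  by_contra hf
  rw [← ne_eq, ← f.ne_zero_iff_of_perm w (Equiv.swap 0 i)] at hf
  apply hf
  have hne : Equiv.swap 0 i j ≠ 0 := by
    intro h0
    rw [Equiv.swap_apply_eq_iff, Equiv.swap_apply_left] at h0
    exact hij h0.symm
  obtain ⟨k, hk⟩ := Fin.exists_succ_eq.2 hne
  have hk' : Fin.tail (w ∘ Equiv.swap 0 i) k = w j := by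
    simp [Fin.tail, hk]
  have h1 := (f.curryLeft (w i)).eq_zero_of_curryLeft_eq_zero (Fin.tail (w ∘ Equiv.swap 0 i)) k
    (by rw [hk']; exact h)
  rw [AlternatingMap.curryLeft_apply_apply] at h1
  convert h1 using 2
  conv_lhs => rw [← Fin.cons_self_tail (w ∘ Equiv.swap 0 i)]
  simp [Matrix.vecCons]

theorem AlternatingMap.map_update_sum_smul {r s : ℕ} (f : V [⋀^Fin r]→ₗ[F] F) (w : Fin r → V)
    (e : Fin s → Fin r) (he : Function.Injective e) (c : Fin s → F) (i : Fin s) :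
    f (Function.update w (e i) (∑ j, c j • w (e j))) = c i * f w := by
  rw [f.map_update_sum, Finset.sum_eq_single i]
  · simp [f.map_update_smul]
  · intro j _ hj
    rw [f.map_update_smul, f.map_update_self _ (fun h => hj (he h).symm), smul_zero]
  · simp

theorem finrank_add_le_of_forall_sum_notMem [FiniteDimensional F V] {s : ℕ} (N : Submodule F V)
    (v : Fin s → V) (h : ∀ c : Fin s → F, c ≠ 0 → ∑ i, c i • v i ∉ N) :
    finrank F N + s ≤ finrank F V := by
  have hli : LinearIndependent F (fun i => N.mkQ (v i)) := by
    rw [Fintype.linearIndependent_iff]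
    intro c hc i
    by_contra hi
    refine h c (fun h0 => hi (by simp [h0])) ?_
    rw [← Submodule.Quotient.mk_eq_zero, ← Submodule.mkQ_apply, map_sum]
    simpa using hc
  have h1 := hli.fintype_card_le_finrank
  have h2 := N.finrank_quotient_add_finrank
  simp at h1
  omega

/-- The vectors `v` such that `f v x ⋯ = 0` for all `x` in `X`. -/
def AlternatingMap.annihilatorOn {r : ℕ} (f : V [⋀^Fin (r + 2)]→ₗ[F] F) (X : Submodule F V) :
    Submodule F V where
  carrier := {v | ∀ x ∈ X, (f.curryLeft v).curryLeft x = 0}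
  add_mem' := by
    intro a b ha hb x hx
    simp [ha x hx, hb x hx]
  zero_mem' := by
    intro x _
    simp
  smul_mem' := by
    intro c a ha x hx
    simp [ha x hx]

theorem AlternatingMap.finrank_ker_curryLeft [FiniteDimensional F V] {r : ℕ}
    (f : V [⋀^Fin (r + 1)]→ₗ[F] F) (w : Fin (r + 1) → V) (hw : f w ≠ 0) :
    finrank F (LinearMap.ker f.curryLeft) + (r + 1) ≤ finrank F V := by
  refine finrank_add_le_of_forall_sum_notMem _ w fun c hc hmem => ?_
  obtain ⟨i, hi⟩ := Function.ne_iff.1 hc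
  have h1 := f.map_update_sum_smul w id Function.injective_id c i
  rw [f.eq_zero_of_curryLeft_eq_zero _ i (by simpa using hmem)] at h1
  exact mul_ne_zero hi hw h1.symm

theorem AlternatingMap.finrank_annihilatorOn [FiniteDimensional F V] {r : ℕ}
    (f : V [⋀^Fin (r + 2)]→ₗ[F] F) (X : Submodule F V) (w : Fin (r + 2) → V) (h0 : w 0 ∈ X)
    (hw : f w ≠ 0) : finrank F (f.annihilatorOn X) + (r + 1) ≤ finrank F V := by
  refine finrank_add_le_of_forall_sum_notMem _ (fun i => w (Fin.succ i)) fun c hc hmem => ?_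
  obtain ⟨i, hi⟩ := Function.ne_iff.1 hc
  have h1 := f.map_update_sum_smul w Fin.succ (Fin.succ_injective _) c i
  rw [f.eq_zero_of_curryLeft_curryLeft_eq_zero _ i.succ 0 (Fin.succ_ne_zero i) (by
    rw [Function.update_self, Function.update_of_ne (Fin.succ_ne_zero i).symm]
    exact hmem _ h0)] at h1
  exact mul_ne_zero hi hw h1.symm

theorem AlternatingMap.finrank_annihilatorOn_of_mem_of_mem [FiniteDimensional F V] {r : ℕ}
    (f : V [⋀^Fin (r + 2)]→ₗ[F] F) (X : Submodule F V) (w : Fin (r + 2) → V) (h0 : w 0 ∈ X)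
    (h1 : w 1 ∈ X) (hw : f w ≠ 0) :
    finrank F (f.annihilatorOn X) + (r + 2) ≤ finrank F V := by
  refine finrank_add_le_of_forall_sum_notMem _ w fun c hc hmem => ?_
  obtain ⟨i, hi⟩ := Function.ne_iff.1 hc
  obtain ⟨j, hji, hj⟩ : ∃ j, j ≠ i ∧ w j ∈ X := by
    by_cases h : i = 0
    · exact ⟨1, by simp [h], h1⟩
    · exact ⟨0, Ne.symm h, h0⟩
  have h2 := f.map_update_sum_smul w id Function.injective_id c i
  rw [f.eq_zero_of_curryLeft_curryLeft_eq_zero _ i j hji.symm (by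
    rw [id, Function.update_self, Function.update_of_ne hji]
    exact hmem _ hj)] at h2
  exact mul_ne_zero hi hw h2.symm

theorem AlternatingMap.finrank_inf_ker_curryLeft_of_mem [FiniteDimensional F V] {r s : ℕ}
    (f : V [⋀^Fin (r + 1)]→ₗ[F] F) (X : Submodule F V) (w : Fin (r + 1) → V)
    (e : Fin s → Fin (r + 1)) (he : Function.Injective e) (hX : ∀ i, w (e i) ∈ X)
    (hw : f w ≠ 0) :
    finrank F ↥(X ⊓ LinearMap.ker f.curryLeft) + s ≤ finrank F X := by
  have key := finrank_add_le_of_forall_sum_notMem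
    ((LinearMap.ker f.curryLeft).comap X.subtype) (fun i => ⟨w (e i), hX i⟩) fun c hc hmem => by
      obtain ⟨i, hi⟩ := Function.ne_iff.1 hc
      have h2 := f.map_update_sum_smul w e he c i
      rw [f.eq_zero_of_curryLeft_eq_zero _ (e i) (by simpa using hmem)] at h2
      exact mul_ne_zero hi hw h2.symm
  have h3 : finrank F ((LinearMap.ker f.curryLeft).comap X.subtype) =
      finrank F ↥(X ⊓ LinearMap.ker f.curryLeft) := by
    rw [← Submodule.map_comap_subtype]
    exact (Submodule.equivMapOfInjective _ X.injective_subtype _).finrank_eq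
  omega

end AlternatingForms

section Counting

variable {F V}

theorem Submodule.ncard_eq_pow_finrank [Fintype F] [Finite V] (X : Submodule F V) :
    (X : Set V).ncard = Fintype.card F ^ finrank F X := by
  have := Fintype.ofFinite X
  rw [← Module.card_eq_pow_finrank (K := F) (V := X), ← Nat.card_eq_fintype_card]
  rfl

theorem Submodule.ncard_diff [Fintype F] [Finite V] (X Y : Submodule F V) :
    (((X : Set V) \ Y).ncard : ℤ) =
      (Fintype.card F : ℤ) ^ finrank F X - (Fintype.card F : ℤ) ^ finrank F ↥(X ⊓ Y) := by
  have h := Set.ncard_inter_add_ncard_sdiff_eq_ncard (X : Set V) Y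
  rw [← Submodule.coe_inf, Submodule.ncard_eq_pow_finrank, Submodule.ncard_eq_pow_finrank] at h
  have h' := congrArg (Nat.cast : ℕ → ℤ) h
  push_cast at h'
  linarith

theorem Submodule.ncard_compl [Fintype F] [Finite V] (Y : Submodule F V) :
    ((Y : Set V)ᶜ.ncard : ℤ) =
      (Fintype.card F : ℤ) ^ finrank F V - (Fintype.card F : ℤ) ^ finrank F Y := by
  have h := Submodule.ncard_diff ⊤ Y
  rwa [top_inf_eq, finrank_top, Submodule.top_coe, ← Set.compl_eq_univ_sdiff] at h

/-- The number of `r`-tuples in a space with `q ^ m` elements whose entries avoid, in turn,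
subspaces of codimension `r, r - 1, …, 1`. -/
def tupleBound (q m r : ℕ) : ℤ := ∏ i ∈ Finset.range r, ((q : ℤ) ^ m - (q : ℤ) ^ (m - 1 - i))

theorem tupleBound_succ (q m r : ℕ) :
    tupleBound q m (r + 1) = tupleBound q m r * ((q : ℤ) ^ m - (q : ℤ) ^ (m - 1 - r)) :=
  Finset.prod_range_succ _ _

theorem tupleBound_nonneg {q : ℕ} (hq : 1 ≤ q) (m r : ℕ) : 0 ≤ tupleBound q m r := by
  refine Finset.prod_nonneg fun i _ => ?_
  have h : (q : ℤ) ^ (m - 1 - i) ≤ (q : ℤ) ^ m :=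
    pow_le_pow_right₀ (by exact_mod_cast hq) (by omega)
  linarith

theorem ncard_tuple_succ {V : Type*} [Fintype V] {r : ℕ} (P : (Fin (r + 1) → V) → Prop) :
    {v | P v}.ncard = ∑ x : V, {t : Fin r → V | P (Matrix.vecCons x t)}.ncard := by
  classical
  simp only [Set.ncard_eq_toFinset_card', Set.toFinset_ofPred, Finset.card_filter]
  rw [← (Fin.consEquiv (fun _ => V)).sum_comp, Fintype.sum_prod_type]
  rfl

theorem le_mul_ncard_tuple_succ {V : Type*} [Finite V] {r : ℕ} (P : (Fin (r + 1) → V) → Prop)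
    (S T : Set V) (hST : Disjoint S T) (c d k : ℤ) (hk : 0 ≤ k)
    (hS : ∀ x ∈ S, c ≤ k * {t : Fin r → V | P (Matrix.vecCons x t)}.ncard)
    (hT : ∀ x ∈ T, d ≤ k * {t : Fin r → V | P (Matrix.vecCons x t)}.ncard) :
    S.ncard * c + T.ncard * d ≤ k * {v | P v}.ncard := by
  classical
  have := Fintype.ofFinite V
  rw [ncard_tuple_succ, Set.ncard_eq_toFinset_card', Set.ncard_eq_toFinset_card',
    ← nsmul_eq_mul, ← nsmul_eq_mul]
  push_cast
  rw [Finset.mul_sum]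
  calc _ ≤ ∑ x ∈ S.toFinset, k * ({t : Fin r → V | P (Matrix.vecCons x t)}.ncard : ℤ) +
          ∑ x ∈ T.toFinset, k * ({t : Fin r → V | P (Matrix.vecCons x t)}.ncard : ℤ) :=
        add_le_add (Finset.card_nsmul_le_sum _ _ _ (by simpa using hS))
          (Finset.card_nsmul_le_sum _ _ _ (by simpa using hT))
    _ = ∑ x ∈ S.toFinset ∪ T.toFinset,
          k * ({t : Fin r → V | P (Matrix.vecCons x t)}.ncard : ℤ) :=
        (Finset.sum_union (by simpa using hST)).symm
    _ ≤ _ := Finset.sum_le_univ_sum_of_nonneg fun _ => by positivity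

theorem AlternatingMap.tupleBound_le_ncard_ne_zero [Fintype F] [Finite V] {r : ℕ}
    (f : V [⋀^Fin r]→ₗ[F] F) (hf : ∃ w, f w ≠ 0) :
    tupleBound (Fintype.card F) (finrank F V) r ≤ {v | f v ≠ 0}.ncard := by
  induction r with
  | zero =>
    have : 0 < {v | f v ≠ 0}.ncard := (Set.ncard_pos).2 hf
    simp only [tupleBound, Finset.range_zero, Finset.prod_empty]
    exact_mod_cast this
  | succ r ih =>
    obtain ⟨w, hw⟩ := hf
    set q := Fintype.card F with hqdef
    set m := finrank F V with hm
    have hq : 1 ≤ q := Fintype.card_pos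
    have hN := f.finrank_ker_curryLeft w hw
    set N := LinearMap.ker f.curryLeft with hNdef
    have h1 := le_mul_ncard_tuple_succ (fun v => f v ≠ 0) (N : Set V)ᶜ ∅ (by simp)
      (tupleBound q m r) 0 1 zero_le_one (fun x hx => by
        rw [one_mul]
        refine ih (f.curryLeft x) ?_
        by_contra! h
        apply hx
        rw [hNdef, SetLike.mem_coe, LinearMap.mem_ker]
        ext t
        exact h t) (by simp)
    have h3 : (q : ℤ) ^ finrank F N ≤ q ^ (m - 1 - r) :=
      pow_le_pow_right₀ (by exact_mod_cast hq) (by omega)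
    have h4 := tupleBound_nonneg hq m r
    rw [tupleBound_succ]
    rw [one_mul] at h1
    refine le_trans ?_ h1
    rw [N.ncard_compl, ← hqdef, ← hm, mul_comm, mul_zero, add_zero]
    gcongr

theorem AlternatingMap.exists_ne_zero_of_notMem_ker_curryLeft {r : ℕ}
    (f : V [⋀^Fin (r + 1)]→ₗ[F] F) {x : V} (hx : x ∉ LinearMap.ker f.curryLeft) :
    ∃ w, f.curryLeft x w ≠ 0 := by
  by_contra! h
  exact hx (LinearMap.mem_ker.2 (AlternatingMap.ext h))

theorem AlternatingMap.tupleBound_le_ncard_vecCons_of_mem [Fintype F] [Finite V] {r : ℕ}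
    (f : V [⋀^Fin (r + 1)]→ₗ[F] F) (X : Submodule F V) {x : V} (hxX : x ∈ X)
    (hx : x ∉ LinearMap.ker f.curryLeft) :
    tupleBound (Fintype.card F) (finrank F V) r ≤ {t | f (Matrix.vecCons x t) ≠ 0 ∧
      ∃ c : Fin (r + 1) → F, c ≠ 0 ∧ ∑ i, c i • Matrix.vecCons x t i ∈ X}.ncard := by
  refine ((f.curryLeft x).tupleBound_le_ncard_ne_zero
    (f.exists_ne_zero_of_notMem_ker_curryLeft hx)).trans ?_
  refine Nat.cast_le.2 (Set.ncard_le_ncard (fun t ht => ⟨ht, Pi.single 0 1, by simp, ?_⟩))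
  rw [Finset.sum_eq_single 0 (fun i _ hi => by simp [hi]) (by simp)]
  simpa using hxX

theorem exists_sum_smul_vecCons_mem {r : ℕ} (X : Submodule F V) (x : V) (t : Fin r → V)
    (h : ∃ c : Fin r → F, c ≠ 0 ∧ ∑ i, c i • t i ∈ X ⊔ F ∙ x) :
    ∃ c : Fin (r + 1) → F, c ≠ 0 ∧ ∑ i, c i • Matrix.vecCons x t i ∈ X := by
  obtain ⟨c, hc, hmem⟩ := h
  obtain ⟨y, hy, z, hz, hyz⟩ := Submodule.mem_sup.1 hmem
  obtain ⟨a, rfl⟩ := Submodule.mem_span_singleton.1 hz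
  refine ⟨Matrix.vecCons (-a) c, fun h0 => hc ?_, ?_⟩
  · ext i
    simpa using congrFun h0 i.succ
  · rw [Fin.sum_univ_succ]
    simp only [Matrix.cons_val_zero, Matrix.cons_val_succ, ← hyz]
    convert hy using 1
    module

theorem AlternatingMap.tupleBound_le_mul_ncard_ne_zero_and_sum_mem [Fintype F] [Finite V] {r : ℕ}
    (f : V [⋀^Fin (r + 1)]→ₗ[F] F) (X : Submodule F V) (hX : finrank F X + r + 2 = finrank F V)
    (hf : ∃ w, w 0 ∈ X ∧ f w ≠ 0) :
    tupleBound (Fintype.card F) (finrank F V) (r + 1) ≤ (Fintype.card F : ℤ) ^ 2 *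
      {v | f v ≠ 0 ∧ ∃ c : Fin (r + 1) → F, c ≠ 0 ∧ ∑ i, c i • v i ∈ X}.ncard := by
  induction r generalizing X with
  | zero =>
    obtain ⟨w, h0, hw⟩ := hf
    have hU := f.finrank_inf_ker_curryLeft_of_mem X w (s := 1) (fun _ => 0)
      (Function.injective_of_subsingleton _) (fun _ => h0) hw
    have h1 := le_mul_ncard_tuple_succ
      (fun v => f v ≠ 0 ∧ ∃ c : Fin (0 + 1) → F, c ≠ 0 ∧ ∑ i, c i • v i ∈ X)
      ((X : Set V) \ LinearMap.ker f.curryLeft) ∅ (by simp)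
      (tupleBound (Fintype.card F) (finrank F V) 0) 0 1 zero_le_one (fun x hx => by
        rw [one_mul]
        exact f.tupleBound_le_ncard_vecCons_of_mem X hx.1 hx.2) (by simp)
    rw [Submodule.ncard_diff] at h1
    simp only [tupleBound, zero_add, Finset.prod_range_one, Finset.prod_range_zero, ← hX] at h1 ⊢
    have hq : (1 : ℤ) ≤ Fintype.card F := by exact_mod_cast Fintype.card_pos (α := F)
    generalize (Fintype.card F : ℤ) = q at *
    have h2 : q ^ 2 * q ^ finrank F ↥(X ⊓ LinearMap.ker f.curryLeft) ≤
        q ^ (finrank F X + 0 + 2 - 1 - 0) := by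
      rw [← pow_add]
      exact pow_le_pow_right₀ hq (by omega)
    have h3 : q ^ (finrank F X + 0 + 2) = q ^ 2 * q ^ finrank F X := by ring
    have h4 := mul_le_mul_of_nonneg_left h1 (by positivity : 0 ≤ q ^ 2)
    linarith
  | succ r ih =>
    obtain ⟨w, h0, hw⟩ := hf
    have hU := f.finrank_inf_ker_curryLeft_of_mem X w (s := 1) (fun _ => 0)
      (Function.injective_of_subsingleton _) (fun _ => h0) hw
    have hZ := f.finrank_annihilatorOn X w h0 hw
    have hq : (2 : ℤ) ≤ Fintype.card F := by exact_mod_cast Fintype.one_lt_card (α := F)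
    have hb := tupleBound_nonneg (by exact_mod_cast Fintype.card_pos (α := F) :
      1 ≤ Fintype.card F) (finrank F V) (r + 1)
    have h1 := le_mul_ncard_tuple_succ
      (fun v => f v ≠ 0 ∧ ∃ c : Fin (r + 1 + 1) → F, c ≠ 0 ∧ ∑ i, c i • v i ∈ X)
      ((X : Set V) \ LinearMap.ker f.curryLeft) ((X : Set V)ᶜ \ f.annihilatorOn X)
      (disjoint_compl_right.mono Set.sdiff_subset Set.sdiff_subset)
      (Fintype.card F ^ 2 * tupleBound (Fintype.card F) (finrank F V) (r + 1))
      (tupleBound (Fintype.card F) (finrank F V) (r + 1)) (Fintype.card F ^ 2) (by positivity)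
      (fun x hx => by
        gcongr
        exact f.tupleBound_le_ncard_vecCons_of_mem X hx.1 hx.2)
      (fun x hx => by
        have hx0 : x ≠ 0 := fun h => hx.1 (by simp [h])
        have hdisj : X ⊓ F ∙ x = ⊥ := by
          rw [← disjoint_iff, Submodule.disjoint_span_singleton' hx0]
          exact hx.1
        have hsup := Submodule.finrank_sup_add_finrank_inf_eq X (F ∙ x)
        rw [hdisj, finrank_bot, finrank_span_singleton hx0] at hsup
        obtain ⟨y, hy, hxy⟩ : ∃ y ∈ X, (f.curryLeft x).curryLeft y ≠ 0 := by
          by_contra! h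
          exact hx.2 h
        obtain ⟨t, ht⟩ := (f.curryLeft x).exists_ne_zero_of_notMem_ker_curryLeft hxy
        refine (ih (f.curryLeft x) (X ⊔ F ∙ x) (by omega)
          ⟨Matrix.vecCons y t, Submodule.mem_sup_left (by simpa using hy), ht⟩).trans ?_
        refine mul_le_mul_of_nonneg_left (Nat.cast_le.2 (Set.ncard_le_ncard ?_)) (by positivity)
        exact fun t ht => ⟨ht.1, exists_sum_smul_vecCons_mem X x t ht.2⟩)
    rw [Submodule.ncard_diff] at h1
    rw [tupleBound_succ]
    refine le_trans ?_ h1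
    rw [mul_comm, ← mul_assoc, ← add_mul]
    refine mul_le_mul_of_nonneg_right ?_ hb
    by_cases hXZ : X ≤ f.annihilatorOn X
    · have h2 : ((X : Set V)ᶜ \ f.annihilatorOn X) = (f.annihilatorOn X : Set V)ᶜ := by
        ext v
        simpa using fun hv hvX => hv (hXZ hvX)
      rw [h2, Submodule.ncard_compl, ← hX]
      generalize (Fintype.card F : ℤ) = q at *
      have h3 : q ^ finrank F (f.annihilatorOn X) ≤ q ^ 2 * q ^ finrank F X := by
        rw [← pow_add]
        exact pow_le_pow_right₀ (by linarith) (by omega)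
      have h4 : q ^ 2 * q ^ finrank F ↥(X ⊓ LinearMap.ker f.curryLeft) ≤
          q ^ (finrank F X + (r + 1) + 2 - 1 - (r + 1)) := by
        rw [← pow_add]
        exact pow_le_pow_right₀ (by linarith) (by omega)
      linarith
    · obtain ⟨x, hx, hxZ⟩ := SetLike.not_le_iff_exists.1 hXZ
      obtain ⟨y, hy, hxy⟩ : ∃ y ∈ X, (f.curryLeft x).curryLeft y ≠ 0 := by
        by_contra! h
        exact hxZ h
      obtain ⟨t, ht⟩ := (f.curryLeft x).exists_ne_zero_of_notMem_ker_curryLeft hxy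
      have hU' := f.finrank_inf_ker_curryLeft_of_mem X (Matrix.vecCons x (Matrix.vecCons y t))
        (s := 2) (Fin.castLE (by omega)) (Fin.castLE_injective _)
        (by intro i; fin_cases i <;> simpa) ht
      have hZ' := f.finrank_annihilatorOn_of_mem_of_mem X
        (Matrix.vecCons x (Matrix.vecCons y t)) (by simpa) (by simpa) ht
      have h2 : ((f.annihilatorOn X : Set V)ᶜ.ncard : ℤ) ≤
          ((X : Set V)ᶜ \ f.annihilatorOn X).ncard + (X : Set V).ncard := by
        refine le_trans (Nat.cast_le.2 (Set.ncard_le_ncard ?_))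
          ((Nat.cast_le.2 (Set.ncard_union_le _ _)).trans (Nat.cast_add _ _).le)
        intro v hv
        by_cases hvX : v ∈ X
        · exact Or.inr hvX
        · exact Or.inl ⟨hvX, hv⟩
      rw [Submodule.ncard_compl, Submodule.ncard_eq_pow_finrank, ← hX] at h2
      rw [← hX]
      push_cast at h2
      generalize (Fintype.card F : ℤ) = q at *
      have h3 : q ^ finrank F (f.annihilatorOn X) ≤ q ^ (finrank F X + 1) :=
        pow_le_pow_right₀ (by linarith) (by omega)
      have h4 : q ^ 2 * q ^ finrank F ↥(X ⊓ LinearMap.ker f.curryLeft) ≤ q ^ finrank F X := by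
        rw [← pow_add]
        exact pow_le_pow_right₀ (by linarith) (by omega)
      have h5 : finrank F X + (r + 1) + 2 - 1 - (r + 1) = finrank F X + 1 := by omega
      rw [h5]
      have h6 : 2 * 2 * q ^ finrank F X ≤ q ^ 2 * q ^ finrank F X := by
        rw [sq]
        gcongr
      have h7 : 0 < q ^ finrank F X := by positivity
      linarith

end Counting

section SchubertVariety

variable {F V}

theorem AlternatingMap.exists_apply_zero_mem_of_sum_mem {r : ℕ} (f : V [⋀^Fin (r + 1)]→ₗ[F] F)
    (X : Submodule F V) (v : Fin (r + 1) → V) (hv : f v ≠ 0) (c : Fin (r + 1) → F) (hc : c ≠ 0)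
    (hX : ∑ i, c i • v i ∈ X) : ∃ w, w 0 ∈ X ∧ f w ≠ 0 := by
  obtain ⟨i, hi⟩ := Function.ne_iff.1 hc
  refine ⟨Function.update v i (∑ j, c j • v j) ∘ Equiv.swap 0 i, by simpa using hX, ?_⟩
  rw [f.ne_zero_iff_of_perm]
  have h := f.map_update_sum_smul v id Function.injective_id c i
  simp only [id] at h
  rw [h]
  exact mul_ne_zero hi hv

theorem AlternatingMap.linearIndependent_of_apply_ne_zero {r : ℕ} (f : V [⋀^Fin r]→ₗ[F] F)
    (v : Fin r → V) (hv : f v ≠ 0) : LinearIndependent F v := by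
  by_contra h
  exact hv (f.map_linearDependent v h)

theorem AlternatingMap.apply_eq_zero_of_mem_span {r : ℕ} (f : V [⋀^Fin r]→ₗ[F] F)
    (w : Fin r → V) (hw : LinearIndependent F w) (hfw : f w = 0) (v : Fin r → V)
    (hv : ∀ i, v i ∈ Submodule.span F (Set.range w)) : f v = 0 := by
  let e := Basis.span hw
  let g := f.compLinearMap (Submodule.span F (Set.range w)).subtype
  have he : g e = 0 := by
    rw [← hfw]
    simp [g, e, Basis.span_apply]
  have hg : g = 0 := by rw [g.eq_smul_basis_det e, he, zero_smul]
  exact DFunLike.congr_fun hg fun i => ⟨v i, hv i⟩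

theorem not_liesOn_span {r : ℕ} (φ : ⋀[F]^r V →ₗ[F] F) (v : Fin r → V)
    (hv : φ.compAlternatingMap (exteriorPower.ιMulti F r) v ≠ 0) :
    ¬ LiesOn F V r φ (Submodule.span F (Set.range v)) := by
  rintro ⟨ω, -, hω, hspan, h0⟩
  refine hv (AlternatingMap.apply_eq_zero_of_mem_span _ ω hω h0 v fun i => ?_)
  rw [hspan]
  exact Submodule.subset_span (Set.mem_range_self i)

theorem ncard_tuples_le_mul_ncard_span [Fintype F] [Finite V] {r : ℕ} (T : Set (Fin r → V))
    (S : Set (Submodule F V)) (hT : ∀ v ∈ T, LinearIndependent F v)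
    (hTS : ∀ v ∈ T, Submodule.span F (Set.range v) ∈ S) (hS : ∀ L ∈ S, finrank F L = r) :
    T.ncard ≤ (∏ i : Fin r, (Fintype.card F ^ r - Fintype.card F ^ i.val)) * S.ncard := by
  classical
  have := Fintype.ofFinite V
  have := Fintype.ofFinite (Submodule F V)
  rw [Set.ncard_eq_toFinset_card', Set.ncard_eq_toFinset_card']
  refine Finset.card_le_mul_card_image_of_maps_to
    (f := fun v => Submodule.span F (Set.range v)) (by simpa using hTS) _ fun L hL => ?_
  have hL' := hS L (by simpa using hL)
  have hcard := card_linearIndependent (K := F) (V := L) hL'.ge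
  rw [hL'] at hcard
  rw [← hcard, ← Nat.card_eq_finsetCard]
  have hmem : ∀ v : {v ∈ T.toFinset | Submodule.span F (Set.range v) = L}, ∀ i, v.1 i ∈ L :=
    fun v i => (Finset.mem_filter.1 v.2).2.le (Submodule.subset_span (Set.mem_range_self i))
  refine Nat.card_le_card_of_injective
    (fun v => ⟨fun i => ⟨v.1 i, hmem v i⟩, ?_⟩) ?_
  · have := hT v.1 (by simpa using (Finset.mem_filter.1 v.2).1)
    exact LinearIndependent.of_comp L.subtype this
  · intro v w h
    ext i
    simpa using congrArg Subtype.val (congrFun (congrArg Subtype.val h) i)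

theorem tupleBound_eq_pow_mul_prod {q m r : ℕ} (hq : 1 ≤ q) (hr : r ≤ m) :
    tupleBound q m r =
      (q : ℤ) ^ (r * (m - r)) * ((∏ i : Fin r, (q ^ r - q ^ i.val) : ℕ) : ℤ) := by
  rw [Fin.prod_univ_eq_prod_range (fun i => q ^ r - q ^ i) r, ← Finset.prod_range_reflect,
    mul_comm r, pow_mul, tupleBound]
  push_cast
  rw [← Finset.card_range r, ← Finset.prod_const, Finset.card_range, ← Finset.prod_mul_distrib]
  refine Finset.prod_congr rfl fun i hi => ?_
  have hi' := Finset.mem_range.1 hi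
  rw [Nat.cast_sub (Nat.pow_le_pow_right hq (by omega)), mul_sub]
  push_cast
  rw [← pow_add, ← pow_add]
  congr 2 <;> omega

theorem inSchubertTheta_iff [FiniteDimensional F V] {m l : ℕ} (hV : finrank F V = m)
    (hl : 2 ≤ l) (hlm : l ≤ m - 2) {Vflag : ℕ → Submodule F V}
    (hdim : ∀ i : ℕ, i ≤ m → finrank F (Vflag i) = i) (L : Submodule F V) :
    InSchubertTheta F V m l Vflag L ↔ finrank F L = l ∧ L ⊓ Vflag (m - l - 1) ≠ ⊥ := by
  refine and_congr_right fun hL => ⟨fun h h0 => ?_, fun h j hj hjl => ?_⟩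
  · have h1 := h 1 le_rfl (by omega)
    rw [if_pos rfl, h0, finrank_bot] at h1
    omega
  · by_cases hj1 : j = 1
    · subst hj1
      rw [if_pos rfl]
      exact Submodule.one_le_finrank_iff.2 h
    · rw [if_neg hj1]
      have h1 := Submodule.finrank_sup_add_finrank_inf_eq L (Vflag (m - l + j))
      have h2 := (L ⊔ Vflag (m - l + j)).finrank_le
      have h3 := hdim (m - l + j) (by omega)
      omega

theorem pow_le_ncard_not_liesOn [Fintype F] [Finite V] {r : ℕ} (φ : ⋀[F]^(r + 1) V →ₗ[F] F)
    (W : Submodule F V) (hW : finrank F W + r + 2 = finrank F V)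
    (h2 : 2 ≤ (r + 1) * (finrank F V - (r + 1)))
    (hsome : ∃ L : Submodule F V, (finrank F L = r + 1 ∧ L ⊓ W ≠ ⊥) ∧ ¬ LiesOn F V (r + 1) φ L) :
    Fintype.card F ^ ((r + 1) * (finrank F V - (r + 1)) - 2) ≤
      {L : Submodule F V | (finrank F L = r + 1 ∧ L ⊓ W ≠ ⊥) ∧ ¬ LiesOn F V (r + 1) φ L}.ncard := by
  set f := φ.compAlternatingMap (exteriorPower.ιMulti F (r + 1)) with hf
  have hq : 1 < Fintype.card F := Fintype.one_lt_card
  have hex : ∃ w, w 0 ∈ W ∧ f w ≠ 0 := by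
    obtain ⟨L, ⟨hL, hLW⟩, hLφ⟩ := hsome
    let e := finBasisOfFinrankEq F L hL
    have hspan : Submodule.span F (Set.range fun i => (e i : V)) = L := by
      have := congrArg (Submodule.map L.subtype) e.span_eq
      rwa [Submodule.map_span, ← Set.range_comp, Submodule.map_subtype_top] at this
    have he : f (fun i => (e i : V)) ≠ 0 := fun h0 =>
      hLφ ⟨_, fun i => (e i).2, e.linearIndependent.map' L.subtype L.ker_subtype, hspan, h0⟩
    obtain ⟨u, hu, hu0⟩ := Submodule.exists_mem_ne_zero_of_ne_bot hLW
    have hrepr : ∑ i, e.repr ⟨u, hu.1⟩ i • (e i : V) = u := by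
      have := congrArg L.subtype (e.sum_repr ⟨u, hu.1⟩)
      rwa [map_sum] at this
    refine f.exists_apply_zero_mem_of_sum_mem W _ he (fun i => e.repr ⟨u, hu.1⟩ i) ?_ ?_
    · intro h0
      apply hu0
      rw [← hrepr]
      exact Finset.sum_eq_zero fun i _ => by
        rw [show e.repr ⟨u, hu.1⟩ i = 0 from congrFun h0 i, zero_smul]
    · rw [hrepr]
      exact hu.2
  have h1 := f.tupleBound_le_mul_ncard_ne_zero_and_sum_mem W hW hex
  have h3 := ncard_tuples_le_mul_ncard_span
    {v | f v ≠ 0 ∧ ∃ c : Fin (r + 1) → F, c ≠ 0 ∧ ∑ i, c i • v i ∈ W}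
    {L : Submodule F V | (finrank F L = r + 1 ∧ L ⊓ W ≠ ⊥) ∧ ¬ LiesOn F V (r + 1) φ L}
    (fun v hv => f.linearIndependent_of_apply_ne_zero v hv.1)
    (fun v ⟨hv, c, hc, hmem⟩ => by
      have hli := f.linearIndependent_of_apply_ne_zero v hv
      refine ⟨⟨by simpa using finrank_span_eq_card hli, ?_⟩, not_liesOn_span φ v hv⟩
      refine (Submodule.ne_bot_iff _).2 ⟨∑ i, c i • v i, ⟨?_, hmem⟩, fun h0 => hc ?_⟩
      · exact Submodule.sum_mem _ fun i _ =>
          Submodule.smul_mem _ _ (Submodule.subset_span (Set.mem_range_self i))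
      · exact funext (Fintype.linearIndependent_iff.1 hli c h0))
    (fun L hL => hL.1.1)
  rw [tupleBound_eq_pow_mul_prod hq.le (by omega)] at h1
  have hG : 0 < ∏ i : Fin (r + 1), (Fintype.card F ^ (r + 1) - Fintype.card F ^ i.val) :=
    Finset.prod_pos fun i _ => Nat.sub_pos_of_lt (Nat.pow_lt_pow_right hq i.2)
  have h1' := (by exact_mod_cast h1 : _ ≤ (_ : ℕ)).trans (Nat.mul_le_mul_left _ h3)
  have h4 : Fintype.card F ^ ((r + 1) * (finrank F V - (r + 1))) =
      Fintype.card F ^ 2 * Fintype.card F ^ ((r + 1) * (finrank F V - (r + 1)) - 2) := by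
    rw [← pow_add]
    congr 1
    omega
  rw [h4, mul_assoc, mul_comm _ (Finset.prod _ _)] at h1'
  exact Nat.le_of_mul_le_mul_left (Nat.le_of_mul_le_mul_left h1' (by positivity)) hG

end SchubertVariety

/-- If `2 ≤ ℓ ≤ m−2` and some `L ∈ Ω_θ` does not lie on the hyperplane `Π` of `P(⋀^ℓ V)`
determined by the nonzero functional `φ`, then
`|{L ∈ Ω_θ : L lies on Π}| ≤ n_θ − q^{ℓ(m−ℓ)−2}`, where `n_θ = |Ω_θ|`. -/
theorem stmt14 (F : Type*) [Field F] [Fintype F] (V : Type*) [AddCommGroup V] [Module F V]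
    [FiniteDimensional F V] (q m l : ℕ) (hq : Fintype.card F = q)
    (hV : finrank F V = m) (hl : 2 ≤ l) (hlm : l ≤ m - 2)
    (Vflag : ℕ → Submodule F V) (hmono : Monotone Vflag)
    (hdim : ∀ i : ℕ, i ≤ m → finrank F (Vflag i) = i) (htop : Vflag m = ⊤)
    (φ : ⋀[F]^l V →ₗ[F] F) (hφ : φ ≠ 0)
    (hsome : ∃ L : Submodule F V, InSchubertTheta F V m l Vflag L ∧ ¬ LiesOn F V l φ L) :
    (Nat.card {L : Submodule F V | InSchubertTheta F V m l Vflag L ∧ LiesOn F V l φ L} : ℚ) ≤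
      (Nat.card {L : Submodule F V | InSchubertTheta F V m l Vflag L} : ℚ) -
        (q : ℚ) ^ (l * (m - l) - 2) := by
  obtain ⟨r, rfl⟩ : ∃ r, l = r + 1 := ⟨l - 1, by omega⟩
  subst hq hV
  have : Finite V := Module.finite_of_finite F
  simp only [inSchubertTheta_iff rfl hl hlm hdim] at hsome ⊢
  have hW := hdim (finrank F V - (r + 1) - 1) (by omega)
  have h2 : 2 ≤ (r + 1) * (finrank F V - (r + 1)) := by
    nlinarith [show 2 ≤ finrank F V - (r + 1) by omega]
  have key := pow_le_ncard_not_liesOn φ _ (by omega) h2 hsome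
  have hsplit := Set.ncard_inter_add_ncard_sdiff_eq_ncard
    {L : Submodule F V | finrank F L = r + 1 ∧ L ⊓ Vflag (finrank F V - (r + 1) - 1) ≠ ⊥}
    {L | LiesOn F V (r + 1) φ L}
  rw [le_sub_iff_add_le]
  exact_mod_cast (Nat.add_le_add_left key _).trans hsplit.le
end
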